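/- Let Ψ be a uniformly random bijection from [K]×[K] to {1,…,K²} and let (BRD(t))_{t≥0} be the best-response dynamics with deterministic start BRD(0) = x₀ = (a₀,b₀). Let x₁,…,x_T (T ≥ 1) be profiles such that, for each odd t ≤ T, x_t = (a_t, b_{t−1}) with a_t ∉ {a₀, a₁, …} (a row index not used by any earlier profile in the path), and for each even t ≤ T, x_t = (a_{t−1}, b_t) with b_t a column index not used by any earlier profile in the path. Then P( BRD(t) = x_t for all t = 1,…,T ) = ∏_{t=1}^{T} 1/(tK − h(t)), where h(t) = Σ_{i=1}^{t} ⌊i/2⌋. -/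

import Mathlib

open scoped Classical

noncomputable section

/-- `p` is a pure Nash equilibrium of the potential `Ψ`: a strict minimum of `Ψ`
in its row and in its column. -/
def IsPNE {K : ℕ} (Ψ : Fin K × Fin K → ℝ) (p : Fin K × Fin K) : Prop :=
  (∀ a' : Fin K, a' ≠ p.1 → Ψ p < Ψ (a', p.2)) ∧
  (∀ b' : Fin K, b' ≠ p.2 → Ψ p < Ψ (p.1, b'))

/-- Real-valued potential associated with a bijection into `Fin (K^2)`,
taking values in `{1, …, K²}`. -/
def pot {K : ℕ} (Ψ : (Fin K × Fin K) ≃ Fin (K ^ 2)) (p : Fin K × Fin K) : ℝ :=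
  (Ψ p : ℕ) + 1

/-- The minimizer of the potential `Ψ` in column `b` (the best response of the
row player to `b`). -/
noncomputable def argminRow {K : ℕ} (Ψ : Fin K × Fin K → ℝ) (b : Fin K) : Fin K :=
  have : Nonempty (Fin K) := ⟨b⟩
  Classical.choose (Finite.exists_min fun a : Fin K => Ψ (a, b))

/-- The minimizer of the potential `Ψ` in row `a` (the best response of the
column player to `a`). -/
noncomputable def argminCol {K : ℕ} (Ψ : Fin K × Fin K → ℝ) (a : Fin K) : Fin K :=
  have : Nonempty (Fin K) := ⟨a⟩
  Classical.choose (Finite.exists_min fun b : Fin K => Ψ (a, b))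

/-- Best-response dynamics for the potential `Ψ` started at `p₀`: at even times the
row player moves to the minimizer of the current column, at odd times the column
player moves to the minimizer of the current row (staying put if already there). -/
noncomputable def BRD {K : ℕ} (Ψ : Fin K × Fin K → ℝ) (p₀ : Fin K × Fin K) :
    ℕ → Fin K × Fin K
  | 0 => p₀
  | t + 1 =>
    let p := BRD Ψ p₀ t
    if Even t then (argminRow Ψ p.2, p.2) else (p.1, argminCol Ψ p.1)

/-- The set of pure Nash equilibria of the potential given by the bijection `Ψ`. -/
def pneFinset {K : ℕ} (Ψ : (Fin K × Fin K) ≃ Fin (K ^ 2)) : Finset (Fin K × Fin K) :=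
  Finset.univ.filter fun p => IsPNE (pot Ψ) p

/-- The rank of `η` among the PNE of `Ψ`, ordered by increasing potential value
(the PNE with smallest potential has rank `1`). -/
def rankPNE {K : ℕ} (Ψ : (Fin K × Fin K) ≃ Fin (K ^ 2)) (η : Fin K × Fin K) : ℕ :=
  ((pneFinset Ψ).filter fun p => Ψ p ≤ Ψ η).card

/-- The basin of attraction of `η`: the set of profiles from which the
best-response dynamics is absorbed at `η` (within `2K` steps). -/
noncomputable def BoA {K : ℕ} (Ψ : (Fin K × Fin K) ≃ Fin (K ^ 2))
    (η : Fin K × Fin K) : Finset (Fin K × Fin K) :=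
  Finset.univ.filter fun p => BRD (pot Ψ) p (2 * K) = η

/-- The size of the basin of attraction of the PNE of `Ψ` with the `j`-th smallest
potential value, set to `0` if `Ψ` has fewer than `j` PNE. -/
noncomputable def basinOfRank {K : ℕ} (Ψ : (Fin K × Fin K) ≃ Fin (K ^ 2)) (j : ℕ) : ℕ :=
  ∑ η ∈ (pneFinset Ψ).filter fun η => rankPNE Ψ η = j, (BoA Ψ η).card

/-- `h(t) = Σ_{i=1}^t ⌊i/2⌋`. -/
def hfun (t : ℕ) : ℕ := ∑ i ∈ Finset.Icc 1 t, i / 2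

section Swap

variable {α β : Type*} [DecidableEq α] [LinearOrder β]

/-- If a family of bijections is stable under exchanging `x` with any element of `U`,
then a fraction `1 / #U` of its members attain their minimum over `U` at `x`. -/
theorem card_filter_min_mul_card (S : Finset (α ≃ β)) (U : Finset α) {x : α} (hx : x ∈ U)
    (hS : ∀ y ∈ U, ∀ Ψ ∈ S, (Equiv.swap x y).trans Ψ ∈ S) :
    (S.filter fun Ψ => ∀ z ∈ U, Ψ x ≤ Ψ z).card * U.card = S.card := by
  have hcover : S = U.biUnion fun y => S.filter fun Ψ => ∀ z ∈ U, Ψ y ≤ Ψ z := by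
    ext Ψ
    simp only [Finset.mem_biUnion, Finset.mem_filter]
    constructor
    · intro h
      obtain ⟨y, hy, hmin⟩ := U.exists_min_image Ψ ⟨x, hx⟩
      exact ⟨y, hy, h, hmin⟩
    · rintro ⟨_, _, h, _⟩
      exact h
  have hdisj : (U : Set α).PairwiseDisjoint fun y => S.filter fun Ψ => ∀ z ∈ U, Ψ y ≤ Ψ z := by
    intro y hy y' hy' hne
    refine Finset.disjoint_left.2 fun Ψ h h' => hne ?_
    exact Ψ.injective (le_antisymm ((Finset.mem_filter.1 h).2 y' hy')
      ((Finset.mem_filter.1 h').2 y hy))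
  have hswap : ∀ y ∈ U, ∀ z ∈ U, Equiv.swap x y z ∈ U := by
    intro y hy z hz
    rw [Equiv.swap_apply_def]
    split_ifs <;> assumption
  have hcard : ∀ y ∈ U, (S.filter fun Ψ => ∀ z ∈ U, Ψ y ≤ Ψ z).card =
      (S.filter fun Ψ => ∀ z ∈ U, Ψ x ≤ Ψ z).card := by
    intro y hy
    refine Finset.card_bij' (fun Ψ _ => (Equiv.swap x y).trans Ψ)
      (fun Ψ _ => (Equiv.swap x y).trans Ψ) ?_ ?_ ?_ ?_
    · intro Ψ h
      rw [Finset.mem_filter] at h ⊢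
      refine ⟨hS y hy Ψ h.1, fun z hz => ?_⟩
      simpa using h.2 _ (hswap y hy z hz)
    · intro Ψ h
      rw [Finset.mem_filter] at h ⊢
      refine ⟨hS y hy Ψ h.1, fun z hz => ?_⟩
      simpa using h.2 _ (hswap y hy z hz)
    · intro Ψ _
      ext z
      simp
    · intro Ψ _
      ext z
      simp
  conv_rhs => rw [hcover]
  rw [Finset.card_biUnion hdisj, Finset.sum_congr rfl hcard, Finset.sum_const, smul_eq_mul,
    mul_comm]

/-- For nested sets `U 0 ⊆ U 1 ⊆ …` with `x t ∈ U t` lying outside all earlier sets, the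
events that a bijection is minimal over `U t` at `x t` are independent, each of
probability `1 / #(U t)`. -/
theorem card_filter_forall_min_mul_prod_card [Fintype α] [Fintype β] (T : ℕ) (U : ℕ → Finset α) (x : ℕ → α)
    (hmem : ∀ t < T, x t ∈ U t)
    (hsub : ∀ s t, s < t → t < T → U s ⊆ U t)
    (hnot : ∀ s t, s < t → t < T → x t ∉ U s) :
    (Finset.univ.filter fun Ψ : α ≃ β => ∀ t < T, ∀ z ∈ U t, Ψ (x t) ≤ Ψ z).card *
      ∏ t ∈ Finset.range T, (U t).card = Fintype.card (α ≃ β) := by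
  induction T generalizing U x with
  | zero => simp [Finset.card_univ]
  | succ T ih =>
    have ih' := ih (fun t => U (t + 1)) (fun t => x (t + 1))
      (fun t ht => hmem _ (by omega))
      (fun s t h ht => hsub _ _ (by omega) (by omega))
      (fun s t h ht => hnot _ _ (by omega) (by omega))
    rw [← ih', Finset.prod_range_succ', mul_comm (∏ _ ∈ _, _), ← mul_assoc]
    congr 1
    rw [← card_filter_min_mul_card (Finset.univ.filter fun Ψ : α ≃ β =>
      ∀ t < T, ∀ z ∈ U (t + 1), Ψ (x (t + 1)) ≤ Ψ z) (U 0) (hmem 0 (by omega)) ?_,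
      Finset.filter_filter]
    · congr 2
      ext Ψ
      simp only [Finset.mem_filter, Finset.mem_univ, true_and]
      constructor
      · exact fun h => ⟨fun t ht => h _ (by omega), h 0 (by omega)⟩
      · rintro ⟨h, h0⟩ (_ | t) ht
        · exact h0
        · exact h t (by omega)
    · intro y hy Ψ hΨ
      simp only [Finset.mem_filter, Finset.mem_univ, true_and] at hΨ ⊢
      intro t ht z hz
      have h0 := hsub 0 (t + 1) (by omega) (by omega)
      have hn := hnot 0 (t + 1) (by omega) (by omega)
      have hx : Equiv.swap (x 0) y (x (t + 1)) = x (t + 1) :=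
        Equiv.swap_apply_of_ne_of_ne (fun h => hn (h ▸ hmem 0 (by omega))) (fun h => hn (h ▸ hy))
      have hz' : Equiv.swap (x 0) y z ∈ U (t + 1) := by
        rw [Equiv.swap_apply_def]
        split_ifs
        exacts [h0 hy, h0 (hmem 0 (by omega)), hz]
      simpa [hx] using hΨ t ht _ hz'

end Swap

theorem argminRow_eq_iff {K : ℕ} {Ψ : Fin K × Fin K → ℝ} (hΨ : Function.Injective Ψ)
    (a b : Fin K) : argminRow Ψ b = a ↔ ∀ a', Ψ (a, b) ≤ Ψ (a', b) := by
  have : Nonempty (Fin K) := ⟨b⟩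
  have hspec : ∀ a', Ψ (argminRow Ψ b, b) ≤ Ψ (a', b) :=
    Classical.choose_spec (Finite.exists_min fun a : Fin K => Ψ (a, b))
  refine ⟨fun h => h ▸ hspec, fun h => ?_⟩
  exact congrArg Prod.fst (hΨ (le_antisymm (hspec a) (h _)))

theorem argminCol_eq_iff {K : ℕ} {Ψ : Fin K × Fin K → ℝ} (hΨ : Function.Injective Ψ)
    (a b : Fin K) : argminCol Ψ a = b ↔ ∀ b', Ψ (a, b) ≤ Ψ (a, b') := by
  have : Nonempty (Fin K) := ⟨a⟩
  have hspec : ∀ b', Ψ (a, argminCol Ψ a) ≤ Ψ (a, b') :=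
    Classical.choose_spec (Finite.exists_min fun b : Fin K => Ψ (a, b))
  refine ⟨fun h => h ▸ hspec, fun h => ?_⟩
  exact congrArg Prod.snd (hΨ (le_antisymm (hspec b) (h _)))

theorem pot_le_pot_iff {K : ℕ} (Ψ : (Fin K × Fin K) ≃ Fin (K ^ 2)) (p q : Fin K × Fin K) :
    pot Ψ p ≤ pot Ψ q ↔ Ψ p ≤ Ψ q := by
  simp [pot]

theorem pot_injective {K : ℕ} (Ψ : (Fin K × Fin K) ≃ Fin (K ^ 2)) :
    Function.Injective (pot Ψ) := fun p q h =>
  Ψ.injective (le_antisymm ((pot_le_pot_iff Ψ p q).1 h.le) ((pot_le_pot_iff Ψ q p).1 h.ge))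

/-- The dynamics follows an alternating path exactly when each profile of the path is
minimal on the line along which it was reached. -/
theorem forall_BRD_eq_iff {K : ℕ} (Ψ : (Fin K × Fin K) ≃ Fin (K ^ 2)) (T : ℕ)
    (x : ℕ → Fin K × Fin K)
    (heven : ∀ t < T, Even t → (x (t + 1)).2 = (x t).2)
    (hodd : ∀ t < T, ¬ Even t → (x (t + 1)).1 = (x t).1) :
    (∀ t, 1 ≤ t → t ≤ T → BRD (pot Ψ) (x 0) t = x t) ↔
      ∀ t < T, (Even t → ∀ a, Ψ (x (t + 1)) ≤ Ψ (a, (x t).2)) ∧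
        (¬ Even t → ∀ b, Ψ (x (t + 1)) ≤ Ψ ((x t).1, b)) := by
  have step : ∀ t < T, BRD (pot Ψ) (x 0) t = x t →
      (BRD (pot Ψ) (x 0) (t + 1) = x (t + 1) ↔
        (Even t → ∀ a, Ψ (x (t + 1)) ≤ Ψ (a, (x t).2)) ∧
          (¬ Even t → ∀ b, Ψ (x (t + 1)) ≤ Ψ ((x t).1, b))) := by
    intro t ht h
    rw [BRD, h]
    by_cases he : Even t
    · have hx : x (t + 1) = ((x (t + 1)).1, (x t).2) := Prod.ext rfl (heven t ht he)
      generalize (x (t + 1)).1 = a at hx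
      simp [he, hx, argminRow_eq_iff (pot_injective Ψ), pot_le_pot_iff]
    · have hx : x (t + 1) = ((x t).1, (x (t + 1)).2) := Prod.ext (hodd t ht he) rfl
      generalize (x (t + 1)).2 = b at hx
      simp [he, hx, argminCol_eq_iff (pot_injective Ψ), pot_le_pot_iff]
  constructor
  · intro h t ht
    refine (step t ht ?_).1 (h _ (by omega) (by omega))
    rcases t with _ | t
    · rfl
    · exact h _ (by omega) (by omega)
  · intro h t _ ht
    have : ∀ t ≤ T, BRD (pot Ψ) (x 0) t = x t := by
      intro t
      induction t with
      | zero => exact fun _ => rfl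
      | succ t ih => exact fun ht => (step t (by omega) (ih (by omega))).2 (h t (by omega))
    exact this t ht

/-- The profiles lying on one of the lines along which the path `x` has moved
up to time `t`. -/
def visitedLines {K : ℕ} (x : ℕ → Fin K × Fin K) (t : ℕ) : Finset (Fin K × Fin K) :=
  Finset.univ.filter fun p =>
    (∃ i < t / 2, (x (2 * i + 1)).1 = p.1) ∨ ∃ i < (t + 1) / 2, (x (2 * i)).2 = p.2

theorem mem_visitedLines {K : ℕ} {x : ℕ → Fin K × Fin K} {t : ℕ} {p : Fin K × Fin K} :
    p ∈ visitedLines x t ↔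
      (∃ i < t / 2, (x (2 * i + 1)).1 = p.1) ∨ ∃ i < (t + 1) / 2, (x (2 * i)).2 = p.2 := by
  simp [visitedLines]

theorem hfun_eq (t : ℕ) : hfun t = (t / 2) * ((t + 1) / 2) := by
  have hsucc : ∀ t, hfun (t + 1) = hfun t + (t + 1) / 2 := fun t =>
    Finset.sum_Icc_succ_top (by omega) _
  induction t with
  | zero => simp [hfun]
  | succ t ih =>
    rw [hsucc, ih, show (t + 1 + 1) / 2 = t / 2 + 1 by omega]
    ring

theorem card_visitedLines {K : ℕ} {x : ℕ → Fin K × Fin K} {t : ℕ}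
    (hrow : Set.InjOn (fun i => (x (2 * i + 1)).1) (Finset.range (t / 2)))
    (hcol : Set.InjOn (fun i => (x (2 * i)).2) (Finset.range ((t + 1) / 2))) :
    ((visitedLines x t).card : ℝ) = (t : ℝ) * K - hfun t := by
  set R := (Finset.range (t / 2)).image fun i => (x (2 * i + 1)).1 with hR
  set C := (Finset.range ((t + 1) / 2)).image fun i => (x (2 * i)).2 with hC
  have hRcard : R.card = t / 2 := by rw [hR, Finset.card_image_of_injOn hrow, Finset.card_range]
  have hCcard : C.card = (t + 1) / 2 := by
    rw [hC, Finset.card_image_of_injOn hcol, Finset.card_range]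
  have hcompl : (visitedLines x t)ᶜ = Rᶜ ×ˢ Cᶜ := by
    ext p
    simp [mem_visitedLines, hR, hC]
  have h1 := Finset.card_add_card_compl (visitedLines x t)
  have h2 := Finset.card_add_card_compl R
  have h3 := Finset.card_add_card_compl C
  rw [hcompl, Finset.card_product, Fintype.card_prod, Fintype.card_fin] at h1
  rw [hRcard, Fintype.card_fin] at h2
  rw [hCcard, Fintype.card_fin] at h3
  have h4 : t / 2 + (t + 1) / 2 = t := by omega
  rw [hfun_eq]
  push_cast [← @Nat.cast_inj ℝ] at h1 h2 h3 h4 ⊢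
  rw [← h4]
  generalize ((t / 2 : ℕ) : ℝ) = r at *
  generalize (((t + 1) / 2 : ℕ) : ℝ) = c at *
  rw [show (Rᶜ.card : ℝ) = K - r by linarith, show (Cᶜ.card : ℝ) = K - c by linarith] at h1
  linarith

/-- The probability that the best-response dynamics of a uniformly random potential
follows a prescribed path `x₀, x₁, …, x_T`, in which each odd step moves to a fresh
row and each even step moves to a fresh column, equals `∏_{t=1}^T 1/(tK - h(t))`. -/
theorem stmt10 (K : ℕ) (hK : 2 ≤ K) (T : ℕ) (hT : 1 ≤ T)
    (x : ℕ → Fin K × Fin K)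
    (hodd : ∀ t, 1 ≤ t → t ≤ T → Odd t →
      (x t).2 = (x (t - 1)).2 ∧ ∀ s < t, (x t).1 ≠ (x s).1)
    (heven : ∀ t, 1 ≤ t → t ≤ T → Even t →
      (x t).1 = (x (t - 1)).1 ∧ ∀ s < t, (x t).2 ≠ (x s).2) :
    ((Finset.univ.filter fun Ψ : (Fin K × Fin K) ≃ Fin (K ^ 2) =>
        ∀ t, 1 ≤ t → t ≤ T → BRD (pot Ψ) (x 0) t = x t).card : ℝ) /
      (Fintype.card ((Fin K × Fin K) ≃ Fin (K ^ 2)) : ℝ) =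
    ∏ t ∈ Finset.Icc 1 T, 1 / ((t : ℝ) * K - hfun t) := by
  have hrow : ∀ t s, s < 2 * t + 1 → 2 * t + 1 ≤ T → (x (2 * t + 1)).1 ≠ (x s).1 :=
    fun t s hs ht => (hodd _ (by omega) ht (odd_two_mul_add_one t)).2 s hs
  have hcol : ∀ t s, s < 2 * t → 2 * t ≤ T → (x (2 * t)).2 ≠ (x s).2 :=
    fun t s hs ht => (heven _ (by omega) ht (even_two_mul t)).2 s hs
  have hrow_eq : ∀ t, 2 * t + 2 ≤ T → (x (2 * t + 2)).1 = (x (2 * t + 1)).1 :=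
    fun t ht => (heven _ (by omega) ht (even_two_mul (t + 1))).1
  have hcol_eq : ∀ t, 2 * t + 1 ≤ T → (x (2 * t + 1)).2 = (x (2 * t)).2 :=
    fun t ht => (hodd _ (by omega) ht (odd_two_mul_add_one t)).1
  have hcard : ∀ t ≤ T, ((visitedLines x t).card : ℝ) = (t : ℝ) * K - hfun t := by
    intro t ht
    refine card_visitedLines ?_ ?_
    · intro i hi j hj hij
      simp only [Finset.coe_range, Set.mem_Iio] at hi hj
      rcases lt_trichotomy i j with h | h | h
      · exact (hrow j (2 * i + 1) (by omega) (by omega) hij.symm).elim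
      · exact h
      · exact (hrow i (2 * j + 1) (by omega) (by omega) hij).elim
    · intro i hi j hj hij
      simp only [Finset.coe_range, Set.mem_Iio] at hi hj
      rcases lt_trichotomy i j with h | h | h
      · exact (hcol j (2 * i) (by omega) (by omega) hij.symm).elim
      · exact h
      · exact (hcol i (2 * j) (by omega) (by omega) hij).elim
  have hsub : ∀ s t, s < t → t < T → visitedLines x (s + 1) ⊆ visitedLines x (t + 1) := by
    intro s t hst _ p hp
    rw [mem_visitedLines] at hp ⊢
    exact hp.imp (fun ⟨i, hi, h⟩ => ⟨i, by omega, h⟩) (fun ⟨i, hi, h⟩ => ⟨i, by omega, h⟩)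
  have hmem : ∀ t < T, x (t + 1) ∈ visitedLines x (t + 1) := by
    intro t ht
    rw [mem_visitedLines]
    obtain ⟨k, rfl | rfl⟩ := Nat.even_or_odd' t
    · exact Or.inr ⟨k, by omega, (hcol_eq k (by omega)).symm⟩
    · exact Or.inl ⟨k, by omega, (hrow_eq k (by omega)).symm⟩
  have hnot : ∀ s t, s < t → t < T → x (t + 1) ∉ visitedLines x (s + 1) := by
    intro s t hst ht hp
    rw [mem_visitedLines] at hp
    obtain ⟨k, rfl | rfl⟩ := Nat.even_or_odd' t
    · rcases hp with ⟨i, hi, h⟩ | ⟨i, hi, h⟩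
      · exact hrow k (2 * i + 1) (by omega) (by omega) h.symm
      · rw [hcol_eq k (by omega)] at h
        exact hcol k (2 * i) (by omega) (by omega) h.symm
    · rcases hp with ⟨i, hi, h⟩ | ⟨i, hi, h⟩
      · rw [show 2 * k + 1 + 1 = 2 * k + 2 by omega, hrow_eq k (by omega)] at h
        exact hrow k (2 * i + 1) (by omega) (by omega) h.symm
      · exact hcol (k + 1) (2 * i) (by omega) (by omega) h.symm
  have hevent : ∀ Ψ : (Fin K × Fin K) ≃ Fin (K ^ 2),
      (∀ t, 1 ≤ t → t ≤ T → BRD (pot Ψ) (x 0) t = x t) ↔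
        ∀ t < T, ∀ z ∈ visitedLines x (t + 1), Ψ (x (t + 1)) ≤ Ψ z := by
    intro Ψ
    rw [forall_BRD_eq_iff Ψ T x ?_ ?_]
    · constructor
      · intro h
        have hdec : ∀ s t, s ≤ t → t ≤ T → Ψ (x t) ≤ Ψ (x s) := by
          intro s t hst
          induction t, hst using Nat.le_induction with
          | base => exact fun _ => le_rfl
          | succ t _ ih =>
            intro ht
            refine le_trans ?_ (ih (by omega))
            by_cases he : Even t
            · exact (h t (by omega)).1 he (x t).1
            · exact (h t (by omega)).2 he (x t).2
        intro t ht z hz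
        rcases mem_visitedLines.1 hz with ⟨i, hi, hzi⟩ | ⟨i, hi, hzi⟩
        · refine (hdec (2 * i + 2) (t + 1) (by omega) (by omega)).trans ?_
          have := (h (2 * i + 1) (by omega)).2 (by simp) z.2
          rwa [hzi] at this
        · refine (hdec (2 * i + 1) (t + 1) (by omega) (by omega)).trans ?_
          have := (h (2 * i) (by omega)).1 (by simp) z.1
          rwa [hzi] at this
      · intro h t ht
        refine ⟨fun he a => h t ht _ (mem_visitedLines.2 (Or.inr ?_)),
          fun he b => h t ht _ (mem_visitedLines.2 (Or.inl ?_))⟩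
        · obtain ⟨k, rfl⟩ := he.two_dvd
          exact ⟨k, by omega, rfl⟩
        · obtain ⟨k, rfl⟩ := Nat.not_even_iff_odd.1 he
          exact ⟨k, by omega, rfl⟩
    · intro t ht he
      obtain ⟨k, rfl⟩ := he.two_dvd
      exact hcol_eq k (by omega)
    · intro t ht he
      obtain ⟨k, rfl⟩ := Nat.not_even_iff_odd.1 he
      exact hrow_eq k (by omega)
  have hcount := card_filter_forall_min_mul_prod_card (β := Fin (K ^ 2)) T
    (fun t => visitedLines x (t + 1)) (fun t => x (t + 1)) hmem hsub hnot
  have hprod : ∏ t ∈ Finset.Icc 1 T, 1 / ((t : ℝ) * K - hfun t) =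
      (∏ t ∈ Finset.range T, ((visitedLines x (t + 1)).card : ℝ))⁻¹ := by
    rw [← Finset.prod_inv_distrib, Finset.range_eq_Ico,
      Finset.prod_Ico_add' (fun t => ((visitedLines x t).card : ℝ)⁻¹) 0 T 1]
    refine Finset.prod_congr rfl fun t ht => ?_
    rw [hcard t (Finset.mem_Icc.1 ht).2, one_div]
  have hpos : ∏ t ∈ Finset.range T, ((visitedLines x (t + 1)).card : ℝ) ≠ 0 :=
    Finset.prod_ne_zero_iff.2 fun t ht =>
      Nat.cast_ne_zero.2 (Finset.card_ne_zero_of_mem (hmem t (Finset.mem_range.1 ht)))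
  have hequiv : (Fintype.card ((Fin K × Fin K) ≃ Fin (K ^ 2)) : ℝ) ≠ 0 := by
    have e : (Fin K × Fin K) ≃ Fin (K ^ 2) := Fintype.equivFinOfCardEq (by simp [sq])
    exact Nat.cast_ne_zero.2 (@Fintype.card_ne_zero _ _ ⟨e⟩)
  rw [hprod, div_eq_iff hequiv, eq_inv_mul_iff_mul_eq₀ hpos, mul_comm]
  simp only [hevent]
  exact_mod_cast hcount
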